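/- For every k ≥ 1, the set of k-stack-sortable permutations, i.e., the set of permutations σ such that the k-fold iterate S^k(σ) is the identity permutation, is TOTO-definable. -/

import Mathlib

open FirstOrder

/-- Relation symbols of the language `L2` (TOTO): two binary relation symbols `<P` and `<V`. -/
inductive TwoOrderRel : ℕ → Type
  | ltP : TwoOrderRel 2
  | ltV : TwoOrderRel 2

/-- The first-order language `L2` with exactly two binary relation symbols `<P` and `<V`. -/
def L2 : FirstOrder.Language := ⟨fun _ => Empty, TwoOrderRel⟩

/-- The `L2`-structure `M_σ` associated to a permutation `σ` of `{1,…,n}`: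
the domain is `Fin n`, `i <P j` is interpreted as `i < j`, and `i <V j` as `σ i < σ j`. -/
def permStruc2 {n : ℕ} (σ : Equiv.Perm (Fin n)) : L2.Structure (Fin n) where
  funMap := fun {_} f _ => Empty.elim f
  RelMap
    | .ltP => fun x => x 0 < x 1
    | .ltV => fun x => σ (x 0) < σ (x 1)

/-- Satisfaction of an `L2`-sentence in the structure `M_σ`. -/
def Sat2 {n : ℕ} (σ : Equiv.Perm (Fin n)) (φ : L2.Sentence) : Prop :=
  letI := permStruc2 σ
  (Fin n) ⊨ φ

/-- Realization in `M_σ` of an `L2`-formula with free variables indexed by `α`,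
under the assignment `v`. -/
def Real2 {n : ℕ} {α : Type} (σ : Equiv.Perm (Fin n)) (φ : L2.Formula α)
    (v : α → Fin n) : Prop :=
  letI := permStruc2 σ
  φ.Realize v

/-- The type of all permutations of all finite sizes. -/
def Perms := Σ n : ℕ, Equiv.Perm (Fin n)

/-- A set of permutations is TOTO-definable if some `L2`-sentence defines it. -/
def TOTODef (E : Set Perms) : Prop :=
  ∃ φ : L2.Sentence, ∀ (n : ℕ) (σ : Equiv.Perm (Fin n)), Sat2 σ φ ↔ (⟨n, σ⟩ : Perms) ∈ E

/-- Stack sorting on lists of (distinct) naturals, with fuel (the fuel `l.length` used in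
`stackSort` always suffices): `S([]) = []` and `S(α·m·β) = S(α)·S(β)·m` where `m` is the
maximum entry. -/
def stackSortFuel : ℕ → List ℕ → List ℕ
  | 0, _ => []
  | fuel + 1, l =>
    if l = [] then []
    else
      let m := l.foldr max 0
      let i := l.idxOf m
      stackSortFuel fuel (l.take i) ++ stackSortFuel fuel (l.drop (i + 1)) ++ [m]

/-- The stack-sorting operator on lists of distinct naturals. -/
def stackSort (l : List ℕ) : List ℕ := stackSortFuel l.length l

/-- The one-line word of a permutation `σ` of `Fin n`. -/
def word {n : ℕ} (σ : Equiv.Perm (Fin n)) : List ℕ := List.ofFn fun i => (σ i : ℕ)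

theorem pair_sub_cons (x y h : ℕ) (t : List ℕ) :
    [x, y].Sublist (h :: t) ↔ (x = h ∧ y ∈ t) ∨ [x, y].Sublist t := by
  rw [List.sublist_cons_iff]
  constructor
  · rintro (h1 | ⟨r, h1, h2⟩)
    · exact Or.inr h1
    · simp only [List.cons.injEq] at h1
      obtain ⟨rfl, rfl⟩ := h1
      exact Or.inl ⟨rfl, by simpa using h2⟩
  · rintro (⟨rfl, h2⟩ | h1)
    · exact Or.inr ⟨[y], rfl, by simpa using h2⟩
    · exact Or.inl h1

theorem pair_sub_nil (x y : ℕ) : ¬ [x, y].Sublist ([] : List ℕ) := by simp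

theorem pair_sub_append (x y : ℕ) (s t : List ℕ) :
    [x, y].Sublist (s ++ t) ↔ [x, y].Sublist s ∨ (x ∈ s ∧ y ∈ t) ∨ [x, y].Sublist t := by
  induction s with
  | nil => simp
  | cons h s ih =>
    simp only [List.cons_append, pair_sub_cons, ih, List.mem_append, List.mem_cons]
    tauto

theorem pair_sub_mem {x y : ℕ} {l : List ℕ} (h : [x, y].Sublist l) : x ∈ l ∧ y ∈ l :=
  ⟨h.subset (by simp), h.subset (by simp)⟩

theorem pair_sub_asymm {x y : ℕ} {l : List ℕ} (hl : l.Nodup) (h : [x, y].Sublist l) :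
    ¬ [y, x].Sublist l := by
  induction l with
  | nil => simp
  | cons a t ih =>
    rw [pair_sub_cons] at *
    have := fun (u v : ℕ) (h : [u, v].Sublist t) => pair_sub_mem h
    grind

theorem pair_sub_total {x y : ℕ} {l : List ℕ} (hx : x ∈ l) (hy : y ∈ l) (hxy : x ≠ y) :
    [x, y].Sublist l ∨ [y, x].Sublist l := by
  induction l with
  | nil => simp at hx
  | cons a t ih =>
    rw [pair_sub_cons, pair_sub_cons]
    grind

/-- `b` comes before `a` in the sorted word, given that `a < b`. -/
def InvAt (R : ℕ → ℕ → Prop) (b a : ℕ) : Prop := ∃ c, b < c ∧ R b c ∧ R c a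

/-- The precedence relation after one pass, in terms of the one before. -/
def NextRel (R : ℕ → ℕ → Prop) (a b : ℕ) : Prop :=
  (a < b ∧ ¬ InvAt R b a) ∨ (b < a ∧ InvAt R a b)

theorem nextRel_mono {P R : ℕ → ℕ → Prop} {a b : ℕ} (up : ∀ u v, P u v → R u v)
    (d1 : ∀ c, R b c → R c a → P c a) (d2 : ∀ c, R b c → R c a → P b c)
    (h : NextRel P a b) : NextRel R a b := by
  rcases h with ⟨h, h'⟩ | ⟨h, c, h0, h1, h2⟩
  · refine Or.inl ⟨h, ?_⟩
    rintro ⟨c, h0, h1, h2⟩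
    exact h' ⟨c, h0, d2 c h1 h2, d1 c h1 h2⟩
  · exact Or.inr ⟨h, c, h0, up _ _ h1, up _ _ h2⟩

theorem foldr_max_mem (l : List ℕ) (h : l ≠ []) :
    l.foldr max 0 ∈ l ∧ ∀ x ∈ l, x ≤ l.foldr max 0 := by
  induction l with
  | nil => simp at h
  | cons a t ih =>
    by_cases ht : t = []
    · subst ht; simp
    · have := ih ht
      simp only [List.foldr_cons]
      grind

theorem stackSortFuel_spec (n : ℕ) : ∀ l : List ℕ, l.Nodup → l.length ≤ n →
    (stackSortFuel n l).Perm l ∧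
      (stackSortFuel n l).Pairwise (NextRel fun a b => [a, b].Sublist l) := by
  induction n with
  | zero =>
    intro l _ hl
    have : l = [] := by simpa using hl
    subst this
    simp [stackSortFuel]
  | succ n ih =>
    intro l hnd hlen
    by_cases hl : l = []
    · subst hl; simp [stackSortFuel]
    obtain ⟨hm, hmax⟩ := foldr_max_mem l hl
    rw [stackSortFuel, if_neg hl]
    dsimp only
    generalize l.foldr max 0 = m at *
    have hi : l.idxOf m < l.length := List.idxOf_lt_length_iff.2 hm
    have hsplit : l = l.take (l.idxOf m) ++ m :: l.drop (l.idxOf m + 1) := by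
      conv_lhs => rw [← List.take_append_drop (l.idxOf m) l, List.drop_eq_getElem_cons hi]
      simp
    generalize l.take (l.idxOf m) = s at *
    generalize l.drop (l.idxOf m + 1) = t at *
    subst hsplit
    simp only [List.length_append, List.length_cons] at hlen
    rw [List.nodup_append] at hnd
    obtain ⟨hs, hmt, hdis⟩ := hnd
    rw [List.nodup_cons] at hmt
    obtain ⟨ps, qs⟩ := ih s hs (by omega)
    obtain ⟨pt, qt⟩ := ih t hmt.2 (by omega)
    have key : ∀ u v, [u, v].Sublist (s ++ m :: t) ↔ [u, v].Sublist s ∨ (u ∈ s ∧ (v = m ∨ v ∈ t))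
        ∨ (u = m ∧ v ∈ t) ∨ [u, v].Sublist t := by
      intro u v
      rw [pair_sub_append, pair_sub_cons, List.mem_cons]
    have ms := fun (u v : ℕ) (h : [u, v].Sublist s) => pair_sub_mem h
    have mt := fun (u v : ℕ) (h : [u, v].Sublist t) => pair_sub_mem h
    have hmax' : ∀ x, x ∈ s ∨ x ∈ t → x < m := by
      intro x hx
      have := hmax x (by simp; tauto)
      have : x ≠ m := by grind
      omega
    have hd1 : ∀ x ∈ s, x ∉ t := by grind
    have hms : m ∉ s := by grind
    have hsR : ∀ u v, v ∈ s → [u, v].Sublist (s ++ m :: t) → [u, v].Sublist s ∧ u ∈ s := by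
      intro u v hv h
      rcases (key u v).1 h with h | ⟨_, rfl | h⟩ | ⟨_, h⟩ | h
      · exact ⟨h, (ms _ _ h).1⟩
      · exact absurd hv hms
      · exact absurd h (hd1 _ hv)
      · exact absurd h (hd1 _ hv)
      · exact absurd (mt _ _ h).2 (hd1 _ hv)
    have htR : ∀ u v, u ∈ t → [u, v].Sublist (s ++ m :: t) → [u, v].Sublist t ∧ v ∈ t := by
      intro u v hu h
      rcases (key u v).1 h with h | ⟨h, _⟩ | ⟨rfl, _⟩ | h
      · exact absurd hu (hd1 _ (ms _ _ h).1)
      · exact absurd hu (hd1 _ h)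
      · exact absurd hu hmt.1
      · exact ⟨h, (mt _ _ h).2⟩
    constructor
    · have : (stackSortFuel n s ++ stackSortFuel n t ++ [m]).Perm (s ++ t ++ [m]) :=
        (ps.append pt).append_right _
      refine this.trans ?_
      rw [List.append_assoc]
      exact List.Perm.append_left _ (List.perm_append_singleton _ _)
    · rw [List.pairwise_append, List.pairwise_append]
      refine ⟨⟨?_, ?_, ?_⟩, by simp, ?_⟩
      · refine List.Pairwise.imp_of_mem ?_ qs
        intro a b ha hb h
        rw [ps.mem_iff] at ha hb
        have up : ∀ u v, [u, v].Sublist s → [u, v].Sublist (s ++ m :: t) :=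
          fun u v h => (key u v).2 (Or.inl h)
        exact nextRel_mono up (fun c _ h2 => (hsR c a ha h2).1)
          (fun c h1 h2 => hsR b c (hsR c a ha h2).2 h1 |>.1)
          h
      · refine List.Pairwise.imp_of_mem ?_ qt
        intro a b ha hb h
        rw [pt.mem_iff] at ha hb
        have up : ∀ u v, [u, v].Sublist t → [u, v].Sublist (s ++ m :: t) :=
          fun u v h => (key u v).2 (Or.inr (Or.inr (Or.inr h)))
        exact nextRel_mono up (fun c h1 h2 => (htR c a (htR b c hb h1).2 h2).1)
          (fun c h1 _ => (htR b c hb h1).1) h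
      · intro a ha b hb
        rw [ps.mem_iff] at ha
        rw [pt.mem_iff] at hb
        have hab : a ≠ b := by
          rintro rfl
          exact hd1 _ ha hb
        rcases lt_or_gt_of_ne hab with h | h
        · refine Or.inl ⟨h, ?_⟩
          rintro ⟨c, _, h1, h2⟩
          exact hd1 c (hsR c a ha h2).2 (htR b c hb h1).2
        · exact Or.inr ⟨h, m, hmax' a (Or.inl ha), (key a m).2 (Or.inr (Or.inl ⟨ha, Or.inl rfl⟩)),
            (key m b).2 (Or.inr (Or.inr (Or.inl ⟨rfl, hb⟩)))⟩
      · intro a ha b hb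
        rw [List.mem_append, ps.mem_iff, pt.mem_iff] at ha
        rw [List.mem_singleton] at hb
        subst hb
        refine Or.inl ⟨hmax' a ha, ?_⟩
        rintro ⟨c, h0, h1, _⟩
        have := hmax c (pair_sub_mem h1).2
        omega

theorem stackSort_perm {l : List ℕ} (hl : l.Nodup) : (stackSort l).Perm l :=
  (stackSortFuel_spec _ l hl le_rfl).1

theorem stackSort_rel {l : List ℕ} (hl : l.Nodup) {a b : ℕ} (ha : a ∈ l) (hb : b ∈ l) :
    [a, b].Sublist (stackSort l) ↔ NextRel (fun a b => [a, b].Sublist l) a b := by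
  obtain ⟨hp, hq⟩ := stackSortFuel_spec _ l hl le_rfl
  change (stackSort l).Perm l at hp
  change (stackSort l).Pairwise _ at hq
  rw [List.pairwise_iff_forall_sublist] at hq
  refine ⟨fun h => hq h, fun h => ?_⟩
  have hab : a ≠ b := by
    rintro rfl
    simp [NextRel] at h
  rcases pair_sub_total (hp.mem_iff.2 ha) (hp.mem_iff.2 hb) hab with h1 | h1
  · exact h1
  · have h2 := hq h1
    simp only [NextRel] at h h2
    exfalso
    rcases h with ⟨h, h'⟩ | ⟨h, h'⟩ <;> rcases h2 with ⟨h2, h2'⟩ | ⟨h2, h2'⟩ <;>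
      first
        | omega
        | exact h' h2'
        | exact h2' h'

/-- Precedence, among positions of `σ`, of the corresponding values after `k` passes. -/
def PosRel (k : ℕ) {n : ℕ} (σ : Equiv.Perm (Fin n)) (i j : Fin n) : Prop :=
  [(σ i : ℕ), (σ j : ℕ)].Sublist (stackSort^[k] (word σ))

theorem word_nodup {n : ℕ} (σ : Equiv.Perm (Fin n)) : (word σ).Nodup := by
  unfold word
  rw [List.nodup_ofFn]
  exact Fin.val_injective.comp σ.injective

theorem iter_perm {n : ℕ} (σ : Equiv.Perm (Fin n)) (k : ℕ) :
    (stackSort^[k] (word σ)).Perm (word σ) := by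
  induction k with
  | zero => simp
  | succ k ih =>
    rw [Function.iterate_succ_apply']
    exact (stackSort_perm (ih.nodup_iff.2 (word_nodup σ))).trans ih

theorem mem_word {n : ℕ} (σ : Equiv.Perm (Fin n)) (x : ℕ) :
    x ∈ word σ ↔ ∃ i, (σ i : ℕ) = x := by
  simp [word, List.mem_ofFn]

theorem posRel_zero {n : ℕ} (σ : Equiv.Perm (Fin n)) (i j : Fin n) :
    PosRel 0 σ i j ↔ i < j := by
  have h1 : (word σ).Pairwise (fun a b => ∀ i j, (σ i : ℕ) = a → (σ j : ℕ) = b → i < j) := by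
    unfold word
    rw [List.pairwise_ofFn]
    intro i j hij i' j' h1 h2
    rw [Fin.val_inj, σ.injective.eq_iff] at h1 h2
    subst h1 h2
    exact hij
  rw [List.pairwise_iff_forall_sublist] at h1
  constructor
  · intro h
    exact h1 h i j rfl rfl
  · intro h
    rcases pair_sub_total (l := word σ) ((mem_word σ _).2 ⟨i, rfl⟩) ((mem_word σ _).2 ⟨j, rfl⟩)
      (by rw [ne_eq, Fin.val_inj, σ.injective.eq_iff]; exact h.ne) with h2 | h2
    · exact h2
    · exact absurd (h1 h2 j i rfl rfl) (by omega)

theorem posRel_succ (k : ℕ) {n : ℕ} (σ : Equiv.Perm (Fin n)) (i j : Fin n) :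
    PosRel (k + 1) σ i j ↔
      (σ i < σ j ∧ ¬ ∃ c, σ j < σ c ∧ PosRel k σ j c ∧ PosRel k σ c i) ∨
      (σ j < σ i ∧ ∃ c, σ i < σ c ∧ PosRel k σ i c ∧ PosRel k σ c j) := by
  have hp := iter_perm σ k
  have hinv : ∀ i j : Fin n, InvAt (fun a b => [a, b].Sublist (stackSort^[k] (word σ))) (σ i) (σ j)
      ↔ ∃ c, σ i < σ c ∧ PosRel k σ i c ∧ PosRel k σ c j := by
    intro i j
    constructor
    · rintro ⟨c, h1, h2, h3⟩
      obtain ⟨d, rfl⟩ := (mem_word σ c).1 (hp.mem_iff.1 (pair_sub_mem h2).2)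
      exact ⟨d, h1, h2, h3⟩
    · rintro ⟨c, h1, h2, h3⟩
      exact ⟨σ c, h1, h2, h3⟩
  rw [PosRel, Function.iterate_succ_apply', stackSort_rel (hp.nodup_iff.2 (word_nodup σ))
    (hp.mem_iff.2 ((mem_word σ _).2 ⟨i, rfl⟩)) (hp.mem_iff.2 ((mem_word σ _).2 ⟨j, rfl⟩)),
    NextRel, hinv, hinv]
  simp only [Fin.val_fin_lt]

theorem sorted_iff (k : ℕ) {n : ℕ} (σ : Equiv.Perm (Fin n)) :
    stackSort^[k] (word σ) = word (1 : Equiv.Perm (Fin n)) ↔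
      ∀ i j, PosRel k σ i j → σ i < σ j := by
  have hp := iter_perm σ k
  have hone : (word (1 : Equiv.Perm (Fin n))).Pairwise (· < ·) := by
    unfold word
    rw [List.pairwise_ofFn]
    intro i j h
    exact h
  have hperm : (word σ).Perm (word (1 : Equiv.Perm (Fin n))) := by
    rw [List.perm_ext_iff_of_nodup (word_nodup _) (word_nodup _)]
    intro a
    rw [mem_word, mem_word]
    exact ⟨fun ⟨i, h⟩ => ⟨σ i, h⟩, fun ⟨i, h⟩ => ⟨σ.symm i, by simpa using h⟩⟩
  constructor
  · intro h i j hij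
    rw [PosRel, h] at hij
    exact List.pairwise_iff_forall_sublist.1 hone hij
  · intro h
    refine (hp.trans hperm).eq_of_pairwise ?_ ?_ hone
    · intro a b _ _ h1 h2
      omega
    · rw [List.pairwise_iff_forall_sublist]
      intro a b hab
      obtain ⟨i, rfl⟩ := (mem_word σ a).1 (hp.mem_iff.1 (pair_sub_mem hab).1)
      obtain ⟨j, rfl⟩ := (mem_word σ b).1 (hp.mem_iff.1 (pair_sub_mem hab).2)
      exact h i j hab

/-- The atomic formula `x <P y`. -/
def fP {α : Type} (x y : α) : L2.Formula α :=
  FirstOrder.Language.Relations.formula₂ (L := L2) (TwoOrderRel.ltP : L2.Relations 2)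
    (FirstOrder.Language.Term.var x) (FirstOrder.Language.Term.var y)

/-- The atomic formula `x <V y`. -/
def fV {α : Type} (x y : α) : L2.Formula α :=
  FirstOrder.Language.Relations.formula₂ (L := L2) (TwoOrderRel.ltV : L2.Relations 2)
    (FirstOrder.Language.Term.var x) (FirstOrder.Language.Term.var y)

theorem real_fP {α : Type} {n : ℕ} (σ : Equiv.Perm (Fin n)) (x y : α) (v : α → Fin n) :
    Real2 σ (fP x y) v ↔ v x < v y := by
  letI := permStruc2 σ
  exact (FirstOrder.Language.Formula.realize_rel₂ (L := L2) (M := Fin n)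
    (R := (TwoOrderRel.ltP : L2.Relations 2)) (t₁ := FirstOrder.Language.Term.var x)
    (t₂ := FirstOrder.Language.Term.var y) (v := v)).trans Iff.rfl

theorem real_fV {α : Type} {n : ℕ} (σ : Equiv.Perm (Fin n)) (x y : α) (v : α → Fin n) :
    Real2 σ (fV x y) v ↔ σ (v x) < σ (v y) := by
  letI := permStruc2 σ
  exact (FirstOrder.Language.Formula.realize_rel₂ (L := L2) (M := Fin n)
    (R := (TwoOrderRel.ltV : L2.Relations 2)) (t₁ := FirstOrder.Language.Term.var x)
    (t₂ := FirstOrder.Language.Term.var y) (v := v)).trans Iff.rfl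

theorem real_and {α : Type} {n : ℕ} (σ : Equiv.Perm (Fin n)) (φ ψ : L2.Formula α)
    (v : α → Fin n) : Real2 σ (φ ⊓ ψ) v ↔ Real2 σ φ v ∧ Real2 σ ψ v := by
  letI := permStruc2 σ
  exact FirstOrder.Language.Formula.realize_inf

theorem real_or {α : Type} {n : ℕ} (σ : Equiv.Perm (Fin n)) (φ ψ : L2.Formula α)
    (v : α → Fin n) : Real2 σ (φ ⊔ ψ) v ↔ Real2 σ φ v ∨ Real2 σ ψ v := by
  letI := permStruc2 σ
  exact FirstOrder.Language.Formula.realize_sup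

theorem real_imp {α : Type} {n : ℕ} (σ : Equiv.Perm (Fin n)) (φ ψ : L2.Formula α)
    (v : α → Fin n) : Real2 σ (φ.imp ψ) v ↔ (Real2 σ φ v → Real2 σ ψ v) := by
  letI := permStruc2 σ
  exact FirstOrder.Language.Formula.realize_imp

theorem real_not {α : Type} {n : ℕ} (σ : Equiv.Perm (Fin n)) (φ : L2.Formula α)
    (v : α → Fin n) : Real2 σ φ.not v ↔ ¬ Real2 σ φ v := by
  letI := permStruc2 σ
  exact FirstOrder.Language.Formula.realize_not

theorem real_relabel {α β : Type} {n : ℕ} (σ : Equiv.Perm (Fin n)) (φ : L2.Formula α)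
    (g : α → β) (v : β → Fin n) : Real2 σ (φ.relabel g) v ↔ Real2 σ φ (v ∘ g) := by
  letI := permStruc2 σ
  exact FirstOrder.Language.Formula.realize_relabel

theorem real_exs {α : Type} {n : ℕ} (σ : Equiv.Perm (Fin n)) (φ : L2.Formula (α ⊕ Fin 1))
    (v : α → Fin n) :
    Real2 σ (FirstOrder.Language.Formula.iExs (Fin 1) φ) v ↔
      ∃ c, Real2 σ φ (Sum.elim v (fun _ => c)) := by
  letI := permStruc2 σ
  refine FirstOrder.Language.Formula.realize_iExs.trans ?_
  constructor
  · rintro ⟨i, hi⟩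
    refine ⟨i 0, ?_⟩
    have : i = fun _ => i 0 := by
      funext x
      rw [Subsingleton.elim x 0]
    rw [this] at hi
    exact hi
  · rintro ⟨c, hc⟩
    exact ⟨fun _ => c, hc⟩

/-- The formula `∃ c, x <V c ∧ φ(x,c) ∧ φ(c,y)`. -/
noncomputable def fInv (φ : L2.Formula (Fin 2)) (x y : Fin 2) : L2.Formula (Fin 2) :=
  FirstOrder.Language.Formula.iExs (Fin 1)
    ((fV (Sum.inl x) (Sum.inr 0) ⊓ (φ.relabel ![Sum.inl x, Sum.inr 0] ⊓
      φ.relabel ![Sum.inr 0, Sum.inl y]) : L2.Formula (Fin 2 ⊕ Fin 1)))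

theorem exists_formula (k : ℕ) : ∃ φ : L2.Formula (Fin 2), ∀ (n : ℕ) (σ : Equiv.Perm (Fin n))
    (v : Fin 2 → Fin n), Real2 σ φ v ↔ PosRel k σ (v 0) (v 1) := by
  induction k with
  | zero => exact ⟨fP 0 1, fun n σ v => by rw [real_fP, posRel_zero]⟩
  | succ k ih =>
    obtain ⟨φ, hφ⟩ := ih
    refine ⟨(fV 0 1 ⊓ (fInv φ 1 0).not) ⊔ (fV 1 0 ⊓ fInv φ 0 1), fun n σ v => ?_⟩
    rw [posRel_succ]
    simp only [real_or, real_and, real_not, fInv, real_exs, real_fV, real_relabel, hφ]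
    simp

theorem kStackSortable_TOTO_definable (k : ℕ) (hk : 1 ≤ k) :
    TOTODef {p : Perms |
      stackSort^[k] (word p.2) = word (1 : Equiv.Perm (Fin p.1))} := by
  obtain ⟨φ, hφ⟩ := exists_formula k
  refine ⟨FirstOrder.Language.Formula.iAlls (Fin 2)
    ((φ.imp (fV 0 1)).relabel (Sum.inr : Fin 2 → Empty ⊕ Fin 2)), fun n σ => ?_⟩
  have h1 : Sat2 σ (FirstOrder.Language.Formula.iAlls (Fin 2)
      ((φ.imp (fV 0 1)).relabel (Sum.inr : Fin 2 → Empty ⊕ Fin 2))) ↔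
      ∀ i : Fin 2 → Fin n, Real2 σ ((φ.imp (fV 0 1)).relabel
        (Sum.inr : Fin 2 → Empty ⊕ Fin 2)) (Sum.elim default i) := by
    letI := permStruc2 σ
    exact FirstOrder.Language.Formula.realize_iAlls
  rw [h1]
  refine Iff.trans ?_ (sorted_iff k σ).symm
  simp only [real_relabel, real_imp, real_fV, hφ]
  constructor
  · intro h i j
    exact h ![i, j]
  · intro h v
    exact h (v 0) (v 1)
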